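/- (Strong-type characterization by local testing.) Let 1 < p ≤ q < ∞, let τ = (τ_Q)_{Q∈𝒬} be nonnegative constants, and let σ, ω be weights on ℝ^d. Let 𝔑 = sup{ ‖T_τ(fσ)‖_{L^q(ω)} : f ≥ 0, ‖f‖_{L^p(σ)} ≤ 1 }. Then there are constants c, C > 0 depending only on p, q, d such that c·(⟦σ,ω⟧^Loc_{τ,p,q} + ⟦ω,σ⟧^Loc_{τ,q',p'}) ≤ 𝔑 ≤ C·(⟦σ,ω⟧^Loc_{τ,p,q} + ⟦ω,σ⟧^Loc_{τ,q',p'}), all quantities understood in [0,∞], where ⟦ω,σ⟧^Loc_{τ,q',p'} is the dual local testing constant with the roles of (σ,p,q) and (ω,q',p') interchanged. -/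

import Mathlib

open MeasureTheory ENNReal

noncomputable section

/-- Index set for dyadic cubes of `ℝ^d`: a scale `k : ℤ` and a position `n ∈ ℤ^d`. -/
abbrev DIdx (d : ℕ) : Type := ℤ × (Fin d → ℤ)

/-- The dyadic cube `∏_j [2^k n_j, 2^k (n_j + 1))` of `ℝ^d`. -/
def dcube {d : ℕ} (i : DIdx d) : Set (Fin d → ℝ) :=
  {x | ∀ j, x j ∈ Set.Ico ((2 : ℝ) ^ i.1 * (i.2 j : ℝ)) ((2 : ℝ) ^ i.1 * ((i.2 j : ℝ) + 1))}

/-- The dyadic parent of a dyadic cube: the minimal dyadic cube strictly containing it. -/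
def dparent {d : ℕ} (i : DIdx d) : DIdx d :=
  (i.1 + 1, fun j => Int.fdiv (i.2 j) 2)

/-- The measure `ω dx` on `ℝ^d` associated with a weight `ω`. -/
def wMeasure {d : ℕ} (ω : (Fin d → ℝ) → ℝ≥0∞) : Measure (Fin d → ℝ) :=
  volume.withDensity ω

/-- The average of a nonnegative function `f` over the dyadic cube indexed by `i`,
with respect to the measure `μ`. -/
def cavg {d : ℕ} (μ : Measure (Fin d → ℝ)) (i : DIdx d) (f : (Fin d → ℝ) → ℝ≥0∞) : ℝ≥0∞ :=
  (∫⁻ x in dcube i, f x ∂μ) / μ (dcube i)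

/-- Lebesgue average of a nonnegative function over a dyadic cube. -/
def lavg {d : ℕ} (i : DIdx d) (f : (Fin d → ℝ) → ℝ≥0∞) : ℝ≥0∞ :=
  cavg volume i f

/-- The `L^p` norm (real exponent `p`) of a nonnegative function with respect to `μ`. -/
def lpn {d : ℕ} (p : ℝ) (μ : Measure (Fin d → ℝ)) (f : (Fin d → ℝ) → ℝ≥0∞) : ℝ≥0∞ :=
  (∫⁻ x, f x ^ p ∂μ) ^ (1 / p)

/-- The positive dyadic operator `T_τ f = ∑_Q τ_Q (E_Q f) 1_Q`. -/
def Tdy {d : ℕ} (τ : DIdx d → ℝ≥0∞) (f : (Fin d → ℝ) → ℝ≥0∞) (x : Fin d → ℝ) : ℝ≥0∞ :=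
  ∑' i : DIdx d, (dcube i).indicator (fun _ => τ i * lavg i f) x

/-- The local part `T^in_{τ,R} f = ∑_{Q ⊆ R} τ_Q (E_Q f) 1_Q`. -/
def TdyIn {d : ℕ} (τ : DIdx d → ℝ≥0∞) (R : DIdx d) (f : (Fin d → ℝ) → ℝ≥0∞)
    (x : Fin d → ℝ) : ℝ≥0∞ :=
  ∑' i : {i : DIdx d // dcube i ⊆ dcube R},
    (dcube i.1).indicator (fun _ => τ i.1 * lavg i.1 f) x

/-- The global part `T^out_{τ,R} f = ∑_{Q ⊇ R} τ_Q (E_Q f) 1_Q`. -/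
def TdyOut {d : ℕ} (τ : DIdx d → ℝ≥0∞) (R : DIdx d) (f : (Fin d → ℝ) → ℝ≥0∞)
    (x : Fin d → ℝ) : ℝ≥0∞ :=
  ∑' i : {i : DIdx d // dcube R ⊆ dcube i},
    (dcube i.1).indicator (fun _ => τ i.1 * lavg i.1 f) x

/-- The local testing constant `⟦σ,ω⟧^Loc_{τ,p,q}
= sup_{R : ω(R)>0} ω(R)^{-1/q'} ‖T^in_{τ,R}(1_R ω)‖_{L^{p'}(σ)}`. -/
def locTest {d : ℕ} (p q : ℝ) (τ : DIdx d → ℝ≥0∞) (σ ω : (Fin d → ℝ) → ℝ≥0∞) : ℝ≥0∞ :=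
  ⨆ (R : DIdx d) (_ : wMeasure ω (dcube R) ≠ 0),
    wMeasure ω (dcube R) ^ (-(1 / (q / (q - 1)))) *
      lpn (p / (p - 1)) (wMeasure σ) (TdyIn τ R ((dcube R).indicator ω))

/-- The global testing constant `⟦σ,ω⟧^Glo_{τ,p,q}
= sup_{R : ω(R)>0} ω(R)^{-1/q'} ‖T^out_{τ,R}(1_R ω)‖_{L^{p'}(σ)}`. -/
def gloTest {d : ℕ} (p q : ℝ) (τ : DIdx d → ℝ≥0∞) (σ ω : (Fin d → ℝ) → ℝ≥0∞) : ℝ≥0∞ :=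
  ⨆ (R : DIdx d) (_ : wMeasure ω (dcube R) ≠ 0),
    wMeasure ω (dcube R) ^ (-(1 / (q / (q - 1)))) *
      lpn (p / (p - 1)) (wMeasure σ) (TdyOut τ R ((dcube R).indicator ω))

/-- The least weak-type `L^p(σ) → L^{q,∞}(ω)` constant of `f ↦ T_τ(fσ)`. -/
def weakConst {d : ℕ} (p q : ℝ) (τ : DIdx d → ℝ≥0∞) (σ ω : (Fin d → ℝ) → ℝ≥0∞) : ℝ≥0∞ :=
  sInf {N : ℝ≥0∞ | ∀ f : (Fin d → ℝ) → ℝ≥0∞, Measurable f → lpn p (wMeasure σ) f ≠ ⊤ →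
    ∀ lam : ℝ≥0∞, 0 < lam →
      wMeasure ω {x | lam < Tdy τ (fun y => f y * σ y) x} ≤
        (N * lpn p (wMeasure σ) f / lam) ^ q}


/-- The dual local testing constant `⟦ω,σ⟧^Loc_{τ,q',p'}
= sup_{R : σ(R)>0} σ(R)^{-1/p} ‖T^in_{τ,R}(1_R σ)‖_{L^{q}(ω)}`. -/
def locTestDual {d : ℕ} (p q : ℝ) (τ : DIdx d → ℝ≥0∞) (σ ω : (Fin d → ℝ) → ℝ≥0∞) : ℝ≥0∞ :=
  ⨆ (R : DIdx d) (_ : wMeasure σ (dcube R) ≠ 0),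
    wMeasure σ (dcube R) ^ (-(1 / p)) *
      lpn q (wMeasure ω) (TdyIn τ R ((dcube R).indicator σ))

/-- The `L^p(σ) → L^q(ω)` norm of `f ↦ T_τ(fσ)` over nonnegative `f`. -/
def strongConst {d : ℕ} (p q : ℝ) (τ : DIdx d → ℝ≥0∞) (σ ω : (Fin d → ℝ) → ℝ≥0∞) : ℝ≥0∞ :=
  ⨆ (f : (Fin d → ℝ) → ℝ≥0∞) (_ : Measurable f) (_ : lpn p (wMeasure σ) f ≤ 1),
    lpn q (wMeasure ω) (Tdy τ fun y => f y * σ y)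

section Combinatorics

/-- Elements of `s` are pairwise nested or disjoint. -/
def NestedFamily {X : Type*} (s : Finset (Set X)) : Prop :=
  ∀ A ∈ s, ∀ B ∈ s, (A ∩ B).Nonempty → A ⊆ B ∨ B ⊆ A

lemma NestedFamily.mono {X : Type*} {s t : Finset (Set X)} (ht : NestedFamily t) (h : s ⊆ t) :
    NestedFamily s :=
  fun A hA B hB => ht A (h hA) B (h hB)

/-- A finite family of sets contains a subfamily of principal sets along which `φ` doubles and
which dominates `φ` up to a factor `2`. -/
lemma exists_principal_subfamily {X : Type*} (φ : Set X → ℝ≥0∞) (s : Finset (Set X)) :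
    ∃ t ⊆ s, (∀ Q ∈ s, ∃ P ∈ t, Q ⊆ P ∧ φ Q ≤ 2 * φ P) ∧
      ∀ P ∈ t, ∀ P' ∈ t, P' ⊂ P → 2 * φ P ≤ φ P' := by
  classical
  induction s using Finset.strongInduction with
  | H s ih =>
    rcases s.eq_empty_or_nonempty with rfl | hs
    · exact ⟨∅, by simp⟩
    obtain ⟨Q₀, hQ₀, hmin⟩ := s.exists_minimal hs
    obtain ⟨t, hts, hdom, hdbl⟩ := ih (s.erase Q₀) (Finset.erase_ssubset hQ₀)
    by_cases h : ∃ P ∈ t, Q₀ ⊆ P ∧ φ Q₀ ≤ 2 * φ P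
    · refine ⟨t, hts.trans (Finset.erase_subset _ _), fun Q hQ => ?_, hdbl⟩
      by_cases hQQ : Q = Q₀
      · exact hQQ ▸ h
      · exact hdom Q (Finset.mem_erase.2 ⟨hQQ, hQ⟩)
    · push Not at h
      refine ⟨insert Q₀ t, ?_, fun Q hQ => ?_, fun P hP P' hP' hPP' => ?_⟩
      · exact Finset.insert_subset hQ₀ (hts.trans (Finset.erase_subset _ _))
      · by_cases hQQ : Q = Q₀
        · subst hQQ
          refine ⟨Q, Finset.mem_insert_self _ _, subset_rfl, ?_⟩
          exact le_mul_of_one_le_left zero_le (by norm_num)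
        · obtain ⟨P, hP, hP'⟩ := hdom Q (Finset.mem_erase.2 ⟨hQQ, hQ⟩)
          exact ⟨P, Finset.mem_insert_of_mem hP, hP'⟩
      · rcases Finset.mem_insert.1 hP' with rfl | hP't
        · rcases Finset.mem_insert.1 hP with rfl | hPt
          · exact absurd hPP' (ssubset_irrefl _)
          · exact (h P hPt hPP'.subset).le
        · rcases Finset.mem_insert.1 hP with rfl | hPt
          · have := hmin (Finset.mem_of_mem_erase (hts hP't)) hPP'.subset
            exact absurd (hPP'.subset.antisymm this) hPP'.ne
          · exact hdbl P hPt P' hP't hPP'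

lemma sum_le_mul_of_geometric {ι : Type*} {b : ι → ℝ≥0∞} {θ K : ℝ≥0∞}
    (hK : 1 + K * θ ≤ K) (s : Finset ι)
    (hs : ∀ x ∈ s, ∀ y ∈ s, x ≠ y → b x ≤ θ * b y ∨ b y ≤ θ * b x) :
    ∀ c, (∀ x ∈ s, b x ≤ c) → ∑ x ∈ s, b x ≤ K * c := by
  classical
  induction s using Finset.induction_on_max_value b with
  | empty => simp
  | insert a s ha hmax ih =>
    intro c hc
    have hle : ∀ x ∈ s, b x ≤ θ * b a := by
      intro x hx
      have hxa : x ≠ a := fun h => ha (h ▸ hx)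
      rcases hs x (Finset.mem_insert_of_mem hx) a (Finset.mem_insert_self _ _) hxa with h | h
      · exact h
      · calc b x ≤ b a := hmax x hx
          _ ≤ θ * b x := h
          _ ≤ θ * b a := by gcongr; exact hmax x hx
    have h1 := ih (fun x hx y hy => hs x (Finset.mem_insert_of_mem hx) y
      (Finset.mem_insert_of_mem hy)) _ hle
    rw [Finset.sum_insert ha]
    calc b a + ∑ x ∈ s, b x ≤ b a + K * (θ * b a) := by gcongr
      _ = (1 + K * θ) * b a := by ring
      _ ≤ K * b a := by gcongr
      _ ≤ K * c := by gcongr; exact hc a (Finset.mem_insert_self _ _)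

lemma sum_rpow_le_rpow_sum {ι : Type*} (s : Finset ι) (f : ι → ℝ≥0∞) {p : ℝ} (hp : 1 ≤ p) :
    ∑ i ∈ s, f i ^ p ≤ (∑ i ∈ s, f i) ^ p := by
  classical
  induction s using Finset.induction_on with
  | empty => simp
  | insert a s ha ih =>
    rw [Finset.sum_insert ha, Finset.sum_insert ha]
    exact (by gcongr : _ ≤ _).trans (ENNReal.add_rpow_le_rpow_add _ _ hp)

end Combinatorics

section Carleson

variable {X : Type*} {φ : Set X → ℝ≥0∞} {t : Finset (Set X)} {p p' : ℝ} {K : ℝ≥0∞}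

lemma sum_indicator_rpow_le (hpp' : p.HolderConjugate p') (ht : NestedFamily t)
    (hdbl : ∀ P ∈ t, ∀ P' ∈ t, P' ⊂ P → 2 * φ P ≤ φ P')
    (hK : 1 + K * 2 ^ (-(p - 1)) ≤ K) (x : X) :
    (∑ P ∈ t, P.indicator (fun _ => φ P ^ (p - 1)) x) ^ p' ≤
      K ^ p' * ∑ P ∈ t, P.indicator (fun _ => φ P ^ p) x := by
  classical
  have hp1 : 0 < p - 1 := hpp'.sub_one_pos
  have key : ∀ g : Set X → ℝ≥0∞, ∑ P ∈ t, P.indicator (fun _ => g P) x =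
      ∑ P ∈ t with x ∈ P, g P := by
    intro g
    rw [Finset.sum_filter]
    rfl
  rw [key (fun P => φ P ^ (p - 1)), key (fun P => φ P ^ p)]
  rcases (t.filter (x ∈ ·)).eq_empty_or_nonempty with he | hne
  · simp [he, hpp'.symm.pos]
  obtain ⟨M, hM, hmax⟩ := Finset.exists_max_image _ φ hne
  have hdbl' : ∀ P ∈ t, ∀ P' ∈ t, P' ⊂ P → φ P ^ (p - 1) ≤ 2 ^ (-(p - 1)) * φ P' ^ (p - 1) := by
    intro P hP P' hP' h
    have h2 := ENNReal.rpow_le_rpow (hdbl P hP P' hP' h) hp1.le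
    rw [ENNReal.mul_rpow_of_nonneg _ _ hp1.le] at h2
    calc φ P ^ (p - 1) = 2 ^ (-(p - 1)) * (2 ^ (p - 1) * φ P ^ (p - 1)) := by
          rw [← mul_assoc, ← ENNReal.rpow_add _ _ (by norm_num) (by norm_num)]; simp
      _ ≤ _ := by gcongr
  have hsum : ∑ P ∈ t with x ∈ P, φ P ^ (p - 1) ≤ K * φ M ^ (p - 1) := by
    refine sum_le_mul_of_geometric hK _ (fun P hP P' hP' hne => ?_) _ (fun P hP => ?_)
    · simp only [Finset.mem_filter] at hP hP'
      rcases ht P hP.1 P' hP'.1 ⟨x, hP.2, hP'.2⟩ with h | h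
      · exact Or.inr (hdbl' P' hP'.1 P hP.1 (h.ssubset_of_ne hne))
      · exact Or.inl (hdbl' P hP.1 P' hP'.1 (h.ssubset_of_ne hne.symm))
    · exact ENNReal.rpow_le_rpow (hmax P hP) hp1.le
  calc (∑ P ∈ t with x ∈ P, φ P ^ (p - 1)) ^ p' ≤ (K * φ M ^ (p - 1)) ^ p' :=
        ENNReal.rpow_le_rpow hsum hpp'.symm.nonneg
    _ = K ^ p' * φ M ^ p := by
        rw [ENNReal.mul_rpow_of_nonneg _ _ hpp'.symm.nonneg, ← ENNReal.rpow_mul,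
          hpp'.sub_one_mul_conj]
    _ ≤ _ := by
        gcongr
        exact Finset.single_le_sum (f := fun P => φ P ^ p) (fun _ _ => zero_le) hM

variable [MeasurableSpace X] {μ : Measure X} {f : X → ℝ≥0∞}

/-- Carleson embedding along a family of sets on which the averages of `f` double. -/
lemma sum_rpow_mul_measure_le (hpp' : p.HolderConjugate p') (ht : NestedFamily t)
    (hmeas : ∀ P ∈ t, MeasurableSet P) (hfin : ∀ P ∈ t, μ P ≠ ⊤)
    (hf : Measurable f) (hf1 : ∫⁻ x, f x ^ p ∂μ ≤ 1)
    (hφ : ∀ P ∈ t, φ P * μ P = ∫⁻ x in P, f x ∂μ) (hφtop : ∀ P ∈ t, φ P ≠ ⊤)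
    (hdbl : ∀ P ∈ t, ∀ P' ∈ t, P' ⊂ P → 2 * φ P ≤ φ P')
    (hK : 1 + K * 2 ^ (-(p - 1)) ≤ K) :
    ∑ P ∈ t, φ P ^ p * μ P ≤ K ^ p := by
  classical
  set S := ∑ P ∈ t, φ P ^ p * μ P with hS
  have hp0 := hpp'.pos
  have hp0' := hpp'.symm.pos
  have hStop : S ≠ ⊤ := ENNReal.sum_ne_top.2 fun P hP =>
    ENNReal.mul_ne_top (ENNReal.rpow_ne_top_of_nonneg hp0.le (hφtop P hP)) (hfin P hP)
  set G : X → ℝ≥0∞ := fun x => ∑ P ∈ t, P.indicator (fun _ => φ P ^ (p - 1)) x with hG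
  have hGm : Measurable G :=
    Finset.measurable_fun_sum _ fun P hP => measurable_const.indicator (hmeas P hP)
  have hpow : ∀ P ∈ t, φ P ^ p = φ P ^ (p - 1) * φ P := by
    intro P hP
    have h := ENNReal.rpow_add_of_nonneg (x := φ P) (p - 1) 1 hpp'.sub_one_pos.le zero_le_one
    rw [sub_add_cancel, ENNReal.rpow_one] at h
    exact h
  have h1 : S = ∫⁻ x, (f * G) x ∂μ := by
    simp only [Pi.mul_apply, hG, Finset.mul_sum]
    rw [lintegral_finsetSum' (f := fun (P : Set X) x =>
      f x * P.indicator (fun _ => φ P ^ (p - 1)) x) _ fun P hP =>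
      (hf.mul (measurable_const.indicator (hmeas P hP))).aemeasurable]
    refine Finset.sum_congr rfl fun P hP => ?_
    rw [hpow P hP, mul_assoc, hφ P hP, ← lintegral_const_mul _ hf,
      ← lintegral_indicator (hmeas P hP)]
    refine lintegral_congr fun x => ?_
    by_cases hx : x ∈ P <;> simp [hx, mul_comm]
  have h2 : ∫⁻ x, G x ^ p' ∂μ ≤ K ^ p' * S := by
    calc ∫⁻ x, G x ^ p' ∂μ
        ≤ ∫⁻ x, K ^ p' * ∑ P ∈ t, P.indicator (fun _ => φ P ^ p) x ∂μ :=
          lintegral_mono fun x => sum_indicator_rpow_le hpp' ht hdbl hK x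
      _ = K ^ p' * S := by
          rw [lintegral_const_mul _ (Finset.measurable_fun_sum _ fun P hP =>
            measurable_const.indicator (hmeas P hP)),
            lintegral_finsetSum' _ fun P hP =>
              (measurable_const.indicator (hmeas P hP)).aemeasurable]
          congr 1
          refine Finset.sum_congr rfl fun P hP => ?_
          rw [lintegral_indicator_const (hmeas P hP)]
  have h3 : S ≤ K * S ^ (1 / p') := by
    calc S = ∫⁻ x, (f * G) x ∂μ := h1
      _ ≤ (∫⁻ x, f x ^ p ∂μ) ^ (1 / p) * (∫⁻ x, G x ^ p' ∂μ) ^ (1 / p') :=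
        ENNReal.lintegral_mul_le_Lp_mul_Lq μ hpp' hf.aemeasurable hGm.aemeasurable
      _ ≤ 1 ^ (1 / p) * (K ^ p' * S) ^ (1 / p') := by gcongr
      _ = K * S ^ (1 / p') := by
        rw [ENNReal.one_rpow, one_mul, ENNReal.mul_rpow_of_nonneg _ _ (by positivity),
          ← ENNReal.rpow_mul, mul_one_div_cancel hp0'.ne', ENNReal.rpow_one]
  rcases eq_or_ne S 0 with h0 | h0
  · rw [h0]; exact zero_le
  have h4 : S ^ (1 / p) ≤ K := by
    have h5 : S = S ^ (1 / p) * S ^ (1 / p') := by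
      rw [← ENNReal.rpow_add _ _ h0 hStop]
      simp [hpp'.inv_add_inv_eq_one]
    have h6 : S ^ (1 / p) * S ^ (1 / p') ≤ K * S ^ (1 / p') := h5 ▸ h3
    refine (ENNReal.mul_le_mul_iff_left ?_ ?_).1 h6
    · exact (ENNReal.rpow_pos (pos_iff_ne_zero.2 h0) hStop).ne'
    · exact ENNReal.rpow_ne_top_of_nonneg (by positivity) hStop
  calc S = (S ^ (1 / p)) ^ p := by
        rw [← ENNReal.rpow_mul, one_div_mul_cancel hp0.ne', ENNReal.rpow_one]
    _ ≤ K ^ p := by gcongr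

end Carleson

section Children

variable {X : Type*} {t : Finset (Set X)} {P : Set X}

open Classical in
/-- The maximal elements of `t` strictly contained in `P`. -/
def childrenIn (t : Finset (Set X)) (P : Set X) : Finset (Set X) :=
  {P' ∈ t | P' ⊂ P ∧ ∀ R ∈ t, P' ⊂ R → P ⊆ R}

/-- The part of `P` covered by no strictly smaller element of `t`. -/
def exclusivePart (t : Finset (Set X)) (P : Set X) : Set X :=
  {x ∈ P | ∀ P' ∈ t, P' ⊂ P → x ∉ P'}

/-- The function equal to `g` on the exclusive part of `P` and to `γ P'` on each child `P'`. -/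
def childAverage (t : Finset (Set X)) (γ : Set X → ℝ≥0∞) (g : X → ℝ≥0∞) (P : Set X) (x : X) :
    ℝ≥0∞ :=
  (exclusivePart t P).indicator g x + ∑ P' ∈ childrenIn t P, P'.indicator (fun _ => γ P') x

lemma mem_childrenIn {P' : Set X} :
    P' ∈ childrenIn t P ↔ P' ∈ t ∧ P' ⊂ P ∧ ∀ R ∈ t, P' ⊂ R → P ⊆ R := by
  classical
  simp [childrenIn]

lemma exists_mem_childrenIn (ht : NestedFamily t) (hne : ∀ A ∈ t, A.Nonempty) (hP : P ∈ t)
    {P' : Set X} (hP' : P' ∈ t) (h : P' ⊂ P) : ∃ M ∈ childrenIn t P, P' ⊆ M := by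
  classical
  obtain ⟨M, hM', hM⟩ := Finset.exists_le_maximal (t.filter fun R => P' ⊆ R ∧ R ⊂ P)
    (a := P') (by simp [hP', h])
  have hMt := hM.prop
  simp only [Finset.mem_filter] at hMt
  refine ⟨M, mem_childrenIn.2 ⟨hMt.1, hMt.2.2, fun R hR hMR => ?_⟩, hM'⟩
  obtain ⟨x, hx⟩ := hne M hMt.1
  rcases ht P hP R hR ⟨x, hMt.2.2.subset hx, hMR.subset hx⟩ with h1 | h1
  · exact h1
  · by_contra h2
    have h3 : R ∈ t.filter fun R => P' ⊆ R ∧ R ⊂ P := by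
      simp only [Finset.mem_filter]
      exact ⟨hR, hMt.2.1.trans hMR.subset, h1, h2⟩
    exact hMR.not_subset (hM.le_of_ge h3 hMR.subset)

lemma disjoint_childrenIn (ht : NestedFamily t) {A B : Set X} (hA : A ∈ childrenIn t P)
    (hB : B ∈ childrenIn t P) {x : X} (hxA : x ∈ A) (hxB : x ∈ B) : A = B := by
  rw [mem_childrenIn] at hA hB
  by_contra hne
  rcases ht A hA.1 B hB.1 ⟨x, hxA, hxB⟩ with h | h
  · exact hB.2.1.not_subset (hA.2.2 B hB.1 (h.ssubset_of_ne hne))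
  · exact hA.2.1.not_subset (hB.2.2 A hA.1 (h.ssubset_of_ne (Ne.symm hne)))

lemma sum_sum_childrenIn_le (c : Set X → ℝ≥0∞) :
    ∑ P ∈ t, ∑ P' ∈ childrenIn t P, c P' ≤ ∑ P' ∈ t, c P' := by
  classical
  rw [← Finset.sum_biUnion]
  · refine Finset.sum_le_sum_of_subset fun P' hP' => ?_
    obtain ⟨P, _, h⟩ := Finset.mem_biUnion.1 hP'
    exact (mem_childrenIn.1 h).1
  · intro A hA B hB hAB
    refine Finset.disjoint_left.2 fun P' h1 h2 => hAB ?_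
    rw [mem_childrenIn] at h1 h2
    exact (h1.2.2 B hB h2.2.1).antisymm (h2.2.2 A hA h1.2.1)

lemma measurableSet_exclusivePart [MeasurableSpace X] (hmeas : ∀ A ∈ t, MeasurableSet A)
    (hP : P ∈ t) : MeasurableSet (exclusivePart t P) := by
  have : exclusivePart t P = P \ ⋃ P' ∈ {A ∈ (t : Set (Set X)) | A ⊂ P}, P' := by
    ext x
    simp [exclusivePart]
  rw [this]
  exact (hmeas P hP).diff (MeasurableSet.biUnion
    (t.finite_toSet.subset (Set.sep_subset _ _)).countable fun A hA => hmeas A hA.1)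

lemma measurable_childAverage [MeasurableSpace X] {γ : Set X → ℝ≥0∞} {g : X → ℝ≥0∞}
    (hmeas : ∀ A ∈ t, MeasurableSet A) (hg : Measurable g) (hP : P ∈ t) :
    Measurable (childAverage t γ g P) :=
  (hg.indicator (measurableSet_exclusivePart hmeas hP)).add <|
    Finset.measurable_fun_sum _ fun P' hP' =>
      measurable_const.indicator (hmeas P' (mem_childrenIn.1 hP').1)

lemma childAverage_rpow_le (ht : NestedFamily t) {γ : Set X → ℝ≥0∞} {g : X → ℝ≥0∞}
    {r : ℝ} (hr : 0 < r) (x : X) :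
    childAverage t γ g P x ^ r ≤ (exclusivePart t P).indicator (fun y => g y ^ r) x +
      ∑ P' ∈ childrenIn t P, P'.indicator (fun _ => γ P' ^ r) x := by
  classical
  by_cases hx : ∃ M ∈ childrenIn t P, x ∈ M
  · obtain ⟨M, hM, hxM⟩ := hx
    have hM' := mem_childrenIn.1 hM
    have h1 : x ∉ exclusivePart t P := fun h => h.2 M hM'.1 hM'.2.1 hxM
    have h2 : ∀ c : Set X → ℝ≥0∞,
        ∑ P' ∈ childrenIn t P, P'.indicator (fun _ => c P') x = c M := by
      intro c
      rw [Finset.sum_eq_single_of_mem M hM]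
      · simp [hxM]
      · intro B hB hBM
        exact Set.indicator_of_notMem (fun hxB => hBM (disjoint_childrenIn ht hB hM hxB hxM)) _
    simp only [childAverage]
    rw [h2 γ, h2 fun A => γ A ^ r, Set.indicator_of_notMem h1, Set.indicator_of_notMem h1]
    simp
  · push Not at hx
    have h2 : ∀ c : Set X → ℝ≥0∞,
        ∑ P' ∈ childrenIn t P, P'.indicator (fun _ => c P') x = 0 := fun c =>
      Finset.sum_eq_zero fun B hB => Set.indicator_of_notMem (hx B hB) _
    simp only [childAverage]
    rw [h2 γ, h2 fun A => γ A ^ r]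
    by_cases hxE : x ∈ exclusivePart t P <;> simp [hxE, hr]

lemma sum_indicator_exclusivePart_le (ht : NestedFamily t) (g : X → ℝ≥0∞) (x : X) :
    ∑ P ∈ t, (exclusivePart t P).indicator g x ≤ g x := by
  classical
  by_cases hx : ∃ P ∈ t, x ∈ exclusivePart t P
  · obtain ⟨M, hM, hxM⟩ := hx
    rw [Finset.sum_eq_single_of_mem M hM]
    · exact Set.indicator_le_self _ _ _
    · intro B hB hBM
      refine Set.indicator_of_notMem (fun hxB => ?_) _
      rcases ht M hM B hB ⟨x, hxM.1, hxB.1⟩ with h | h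
      · exact hxB.2 M hM (h.ssubset_of_ne (Ne.symm hBM)) hxM.1
      · exact hxM.2 B hB (h.ssubset_of_ne hBM) hxB.1
  · push Not at hx
    rw [Finset.sum_eq_zero fun B hB => Set.indicator_of_notMem (hx B hB) _]
    exact zero_le

variable [MeasurableSpace X] {ν : Measure X} {g : X → ℝ≥0∞} {γ : Set X → ℝ≥0∞}

/-- Replacing `g` by its averages over the children of `P` does not decrease the integral over
sets contained in `P` but in no smaller element of `t`. -/
lemma setLIntegral_le_childAverage (ht : NestedFamily t) (hne : ∀ A ∈ t, A.Nonempty)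
    (hmeas : ∀ A ∈ t, MeasurableSet A) (hg : Measurable g)
    (hγ : ∀ A ∈ t, γ A * ν A = ∫⁻ x in A, g x ∂ν) (hP : P ∈ t) {Q : Set X}
    (hQ : MeasurableSet Q) (hQP : Q ⊆ P)
    (hnest : ∀ A ∈ t, (A ∩ Q).Nonempty → A ⊆ Q ∨ Q ⊆ A)
    (hmin : ∀ A ∈ t, Q ⊆ A → P ⊆ A) :
    ∫⁻ x in Q, g x ∂ν ≤ ∫⁻ x in Q, childAverage t γ g P x ∂ν := by
  have hcm : ∀ A ∈ childrenIn t P, MeasurableSet A := fun A hA =>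
    hmeas A (mem_childrenIn.1 hA).1
  have hE := measurableSet_exclusivePart hmeas hP
  calc ∫⁻ x in Q, g x ∂ν
      ≤ ∫⁻ x in Q, ((exclusivePart t P).indicator g x +
          ∑ P' ∈ childrenIn t P, P'.indicator g x) ∂ν := by
        refine setLIntegral_mono' hQ fun x hx => ?_
        by_cases hxE : x ∈ exclusivePart t P
        · simp [hxE]
        · have : ∃ A ∈ t, A ⊂ P ∧ x ∈ A := by
            by_contra! h
            exact hxE ⟨hQP hx, h⟩
          obtain ⟨A, hA, hAP, hxA⟩ := this
          obtain ⟨M, hM, hAM⟩ := exists_mem_childrenIn ht hne hP hA hAP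
          calc g x = M.indicator g x := by simp [hAM hxA]
            _ ≤ ∑ P' ∈ childrenIn t P, P'.indicator g x :=
              Finset.single_le_sum (f := fun P' : Set X => P'.indicator g x)
                (fun _ _ => zero_le) hM
            _ ≤ _ := le_add_self
    _ = ∫⁻ x in Q, (exclusivePart t P).indicator g x ∂ν +
          ∑ P' ∈ childrenIn t P, ∫⁻ x in Q, P'.indicator g x ∂ν := by
        rw [lintegral_add_left (hg.indicator hE),
          lintegral_finsetSum' _ fun A hA => (hg.indicator (hcm A hA)).aemeasurable]
    _ ≤ ∫⁻ x in Q, (exclusivePart t P).indicator g x ∂ν +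
          ∑ P' ∈ childrenIn t P, ∫⁻ x in Q, P'.indicator (fun _ => γ P') x ∂ν := by
        refine add_le_add le_rfl (Finset.sum_le_sum fun A hA => ?_)
        have hAt := mem_childrenIn.1 hA
        rw [setLIntegral_indicator (hcm A hA), setLIntegral_indicator (hcm A hA)]
        rcases (A ∩ Q).eq_empty_or_nonempty with h | h
        · simp [h]
        · rcases hnest A hAt.1 h with h' | h'
          · rw [Set.inter_eq_left.2 h', setLIntegral_const, hγ A hAt.1]
          · exact absurd (hmin A hAt.1 h') hAt.2.1.not_subset
    _ = ∫⁻ x in Q, childAverage t γ g P x ∂ν := by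
        simp only [childAverage]
        rw [lintegral_add_left (hg.indicator hE),
          lintegral_finsetSum' _ fun A hA =>
            (measurable_const.indicator (hcm A hA)).aemeasurable]

lemma sum_lintegral_childAverage_rpow_le (ht : NestedFamily t)
    (hmeas : ∀ A ∈ t, MeasurableSet A) (hg : Measurable g) {r : ℝ} (hr : 0 < r) :
    ∑ P ∈ t, ∫⁻ x, childAverage t γ g P x ^ r ∂ν ≤
      ∫⁻ x, g x ^ r ∂ν + ∑ P ∈ t, γ P ^ r * ν P := by
  have hgr : Measurable fun x => g x ^ r := hg.pow_const r
  calc ∑ P ∈ t, ∫⁻ x, childAverage t γ g P x ^ r ∂ν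
      ≤ ∑ P ∈ t, (∫⁻ x, (exclusivePart t P).indicator (fun y => g y ^ r) x ∂ν +
          ∑ P' ∈ childrenIn t P, γ P' ^ r * ν P') := by
        refine Finset.sum_le_sum fun P hP => ?_
        refine (lintegral_mono fun x => childAverage_rpow_le ht hr x).trans_eq ?_
        have hcm : ∀ A ∈ childrenIn t P, MeasurableSet A := fun A hA =>
          hmeas A (mem_childrenIn.1 hA).1
        rw [lintegral_add_left (hgr.indicator (measurableSet_exclusivePart hmeas hP)),
          lintegral_finsetSum' _ fun A hA =>
            (measurable_const.indicator (hcm A hA)).aemeasurable]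
        congr 1
        exact Finset.sum_congr rfl fun A hA => lintegral_indicator_const (hcm A hA) _
    _ = ∫⁻ x, ∑ P ∈ t, (exclusivePart t P).indicator (fun y => g y ^ r) x ∂ν +
          ∑ P ∈ t, ∑ P' ∈ childrenIn t P, γ P' ^ r * ν P' := by
        rw [Finset.sum_add_distrib, lintegral_finsetSum' _ fun A hA =>
          (hgr.indicator (measurableSet_exclusivePart hmeas hA)).aemeasurable]
    _ ≤ _ := add_le_add (lintegral_mono fun x => sum_indicator_exclusivePart_le ht _ x)
        (sum_sum_childrenIn_le _)

end Children

section Duality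

variable {X : Type*} [MeasurableSpace X]

lemma laverage_mul_measure {μ : Measure X} {A : Set X} (hA : μ A ≠ ⊤) (f : X → ℝ≥0∞) :
    (∫⁻ x in A, f x ∂μ) / μ A * μ A = ∫⁻ x in A, f x ∂μ := by
  rcases eq_or_ne (μ A) 0 with h | h
  · simp [h, setLIntegral_measure_zero _ _ h]
  · exact ENNReal.div_mul_cancel h hA

lemma setLIntegral_ne_top_of_rpow {μ : Measure X} {p p' : ℝ} (hpp' : p.HolderConjugate p')
    {f : X → ℝ≥0∞} (hf : Measurable f) (hf1 : ∫⁻ x, f x ^ p ∂μ ≤ 1) {A : Set X} (hA : μ A ≠ ⊤) :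
    ∫⁻ x in A, f x ∂μ ≠ ⊤ := by
  have h := ENNReal.lintegral_mul_le_Lp_mul_Lq (μ.restrict A) hpp' hf.aemeasurable
    (g := fun _ => 1) aemeasurable_const
  simp only [Pi.mul_apply, mul_one, ENNReal.one_rpow, lintegral_const, one_mul,
    Measure.restrict_apply_univ] at h
  refine ne_top_of_le_ne_top (ENNReal.mul_ne_top ?_ ?_) h
  · refine ENNReal.rpow_ne_top_of_nonneg hpp'.one_div_nonneg ?_
    exact ne_top_of_le_ne_top ENNReal.one_ne_top ((setLIntegral_le_lintegral _ _).trans hf1)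
  · exact ENNReal.rpow_ne_top_of_nonneg hpp'.symm.one_div_nonneg hA

/-- The converse of Hölder's inequality for functions with finite `L^q` norm. -/
lemma rpow_lintegral_le_of_forall_dual_of_ne_top {ν : Measure X} {q q' : ℝ}
    (hqq' : q.HolderConjugate q') {h : X → ℝ≥0∞} (hh : Measurable h)
    (hfin : ∫⁻ x, h x ^ q ∂ν ≠ ⊤) {M : ℝ≥0∞}
    (hM : ∀ g : X → ℝ≥0∞, Measurable g → ∫⁻ x, g x ^ q' ∂ν ≤ 1 → ∫⁻ x, h x * g x ∂ν ≤ M) :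
    (∫⁻ x, h x ^ q ∂ν) ^ (1 / q) ≤ M := by
  set I := ∫⁻ x, h x ^ q ∂ν with hI
  rcases eq_or_ne I 0 with h0 | h0
  · rw [h0, ENNReal.zero_rpow_of_pos hqq'.one_div_pos]
    exact zero_le
  have hm : Measurable fun x => h x ^ (q - 1) := hh.pow_const _
  have h1 := hM (fun x => I ^ (-(1 / q')) * h x ^ (q - 1)) (hm.const_mul _) ?_
  · refine le_trans (le_of_eq ?_) h1
    have : ∀ x, h x * (I ^ (-(1 / q')) * h x ^ (q - 1)) = I ^ (-(1 / q')) * h x ^ q := by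
      intro x
      have h2 := ENNReal.rpow_add_of_nonneg (x := h x) (q - 1) 1 hqq'.sub_one_pos.le zero_le_one
      rw [sub_add_cancel, ENNReal.rpow_one] at h2
      rw [h2]; ring
    simp only [this]
    rw [lintegral_const_mul _ (hh.pow_const _), ← hI]
    nth_rw 3 [← ENNReal.rpow_one I]
    rw [← ENNReal.rpow_add _ _ h0 hfin]
    congr 1
    have := hqq'.inv_add_inv_eq_one
    simp only [one_div]; linarith
  · have : ∀ x, (I ^ (-(1 / q')) * h x ^ (q - 1)) ^ q' = I⁻¹ * h x ^ q := by
      intro x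
      rw [ENNReal.mul_rpow_of_nonneg _ _ hqq'.symm.nonneg, ← ENNReal.rpow_mul, ← ENNReal.rpow_mul,
        hqq'.sub_one_mul_conj, neg_mul, one_div_mul_cancel hqq'.symm.ne_zero,
        ENNReal.rpow_neg_one]
    simp only [this]
    rw [lintegral_const_mul _ (hh.pow_const _), ← hI, ENNReal.inv_mul_cancel h0 hfin]

/-- The converse of Hölder's inequality. -/
lemma rpow_lintegral_le_of_forall_dual {ν : Measure X} [SigmaFinite ν] {q q' : ℝ}
    (hqq' : q.HolderConjugate q') {h : X → ℝ≥0∞} (hh : Measurable h) {M : ℝ≥0∞}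
    (hM : ∀ g : X → ℝ≥0∞, Measurable g → ∫⁻ x, g x ^ q' ∂ν ≤ 1 → ∫⁻ x, h x * g x ∂ν ≤ M) :
    (∫⁻ x, h x ^ q ∂ν) ^ (1 / q) ≤ M := by
  have hq := hqq'.pos
  set k : ℕ → X → ℝ≥0∞ := fun n => (spanningSets ν n).indicator fun x => min (h x) n with hk
  have hkm : ∀ n, Measurable (k n) := fun n =>
    (hh.min measurable_const).indicator (measurableSet_spanningSets ν n)
  have hkh : ∀ n x, k n x ≤ h x := fun n x =>
    (Set.indicator_le_self _ _ _).trans (min_le_left _ _)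
  have hmono : Monotone k := by
    intro m n hmn x
    have h1 := monotone_spanningSets ν hmn
    by_cases hx : x ∈ spanningSets ν m
    · simp only [hk, hx, h1 hx, Set.indicator_of_mem]
      exact min_le_min_left _ (by exact_mod_cast hmn)
    · simp [hk, hx]
  have hsup : ∀ x, ⨆ n, k n x ^ q = h x ^ q := by
    intro x
    refine le_antisymm (iSup_le fun n => ENNReal.rpow_le_rpow (hkh n x) hq.le) ?_
    refine le_of_forall_lt fun c hc => ?_
    have hc' : c ^ (1 / q) < h x := by
      have := ENNReal.rpow_lt_rpow hc hqq'.one_div_pos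
      rwa [← ENNReal.rpow_mul, mul_one_div_cancel hq.ne', ENNReal.rpow_one] at this
    obtain ⟨n, hn⟩ := ENNReal.exists_nat_gt hc'.ne_top
    have hx : x ∈ spanningSets ν (max n (spanningSetsIndex ν x)) :=
      monotone_spanningSets ν (le_max_right _ _) (mem_spanningSetsIndex ν x)
    refine lt_iSup_iff.2 ⟨max n (spanningSetsIndex ν x), ?_⟩
    have h3 : c ^ (1 / q) < k (max n (spanningSetsIndex ν x)) x := by
      simp only [hk, hx, Set.indicator_of_mem]
      refine lt_min hc' (hn.trans_le ?_)
      exact_mod_cast le_max_left _ _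
    have := ENNReal.rpow_lt_rpow h3 hq
    rwa [← ENNReal.rpow_mul, one_div_mul_cancel hq.ne', ENNReal.rpow_one] at this
  have hbound : ∀ n, ∫⁻ x, k n x ^ q ∂ν ≤ M ^ q := by
    intro n
    have hfin : ∫⁻ x, k n x ^ q ∂ν ≠ ⊤ := by
      refine ne_top_of_le_ne_top ?_ (lintegral_mono (g := (spanningSets ν n).indicator
        fun _ => (n : ℝ≥0∞) ^ q) fun x => ?_)
      · rw [lintegral_indicator_const (measurableSet_spanningSets ν n)]
        exact ENNReal.mul_ne_top (ENNReal.rpow_ne_top_of_nonneg hq.le (by simp))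
          (measure_spanningSets_lt_top ν n).ne
      · by_cases hx : x ∈ spanningSets ν n
        · simp only [hk, hx, Set.indicator_of_mem]
          exact ENNReal.rpow_le_rpow (min_le_right _ _) hq.le
        · simp [hk, hx, hq]
    have := rpow_lintegral_le_of_forall_dual_of_ne_top hqq' (hkm n) hfin fun g hg hg1 =>
      (lintegral_mono fun x => mul_le_mul_left (hkh n x) _).trans (hM g hg hg1)
    have h2 := ENNReal.rpow_le_rpow this hq.le
    rwa [← ENNReal.rpow_mul, one_div_mul_cancel hq.ne', ENNReal.rpow_one] at h2
  have hle : ∫⁻ x, h x ^ q ∂ν ≤ M ^ q := by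
    simp only [← hsup]
    rw [lintegral_iSup (fun n => (hkm n).pow_const q)
      fun m n hmn x => ENNReal.rpow_le_rpow (hmono hmn x) hq.le]
    exact iSup_le hbound
  have := ENNReal.rpow_le_rpow hle hqq'.one_div_nonneg
  rwa [← ENNReal.rpow_mul, mul_one_div_cancel hq.ne', ENNReal.rpow_one] at this

end Duality

section Testing

variable {X : Type*} [MeasurableSpace X] {μ ν : Measure X} {f g : X → ℝ≥0∞}
  {s : Finset (Set X)} {lam : Set X → ℝ≥0∞} {p p' r r' : ℝ} {K B : ℝ≥0∞}

open Classical in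
/-- Bound of the bilinear form by testing, for sets on which the averages of `g` are controlled by
the averages of `f`. -/
lemma sum_form_le_of_testing_of_le (hpp' : p.HolderConjugate p') (hrr' : r.HolderConjugate r')
    (hrp : r ≤ p') (hK : 1 + K * 2 ^ (-(p - 1)) ≤ K) (hs : NestedFamily s)
    (hne : ∀ A ∈ s, A.Nonempty) (hmeas : ∀ A ∈ s, MeasurableSet A)
    (hμ : ∀ A ∈ s, μ A ≠ ⊤) (hν : ∀ A ∈ s, ν A ≠ ⊤)
    (hf : Measurable f) (hf1 : ∫⁻ x, f x ^ p ∂μ ≤ 1)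
    (hg : Measurable g) (hg1 : ∫⁻ x, g x ^ r ∂ν ≤ 1)
    (hle : ∀ A ∈ s, ((∫⁻ x in A, g x ∂ν) / ν A) ^ r * ν A ≤
      ((∫⁻ x in A, f x ∂μ) / μ A) ^ p * μ A)
    (htest : ∀ R ∈ s, (∫⁻ x, (∑ Q ∈ s with Q ⊆ R, Q.indicator (fun _ => lam Q * μ Q) x) ^ r'
      ∂ν) ^ (1 / r') ≤ B * μ R ^ (1 / p)) :
    ∑ Q ∈ s, lam Q * ((∫⁻ x in Q, f x ∂μ) * ∫⁻ x in Q, g x ∂ν) ≤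
      2 * B * (K * (1 + K ^ p) ^ (1 / r)) := by
  set φ : Set X → ℝ≥0∞ := fun A => (∫⁻ x in A, f x ∂μ) / μ A with hφdef
  set γ : Set X → ℝ≥0∞ := fun A => (∫⁻ x in A, g x ∂ν) / ν A with hγdef
  have hφ : ∀ A ∈ s, φ A * μ A = ∫⁻ x in A, f x ∂μ := fun A hA => laverage_mul_measure (hμ A hA) f
  have hγ : ∀ A ∈ s, γ A * ν A = ∫⁻ x in A, g x ∂ν := fun A hA => laverage_mul_measure (hν A hA) g
  have hφtop : ∀ A ∈ s, φ A ≠ ⊤ := by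
    intro A hA
    rcases eq_or_ne (μ A) 0 with h | h
    · simp [hφdef, h, setLIntegral_measure_zero _ _ h]
    · exact ENNReal.div_ne_top (setLIntegral_ne_top_of_rpow hpp' hf hf1 (hμ A hA)) h
  obtain ⟨t, hts, hdom, hdbl⟩ := exists_principal_subfamily φ s
  have ht := hs.mono hts
  have hcarl : ∑ P ∈ t, φ P ^ p * μ P ≤ K ^ p :=
    sum_rpow_mul_measure_le hpp' ht (fun P hP => hmeas P (hts hP)) (fun P hP => hμ P (hts hP))
      hf hf1 (fun P hP => hφ P (hts hP)) (fun P hP => hφtop P (hts hP)) hdbl hK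
  have hprin : ∀ Q ∈ s, ∃ P ∈ t, Q ⊆ P ∧ φ Q ≤ 2 * φ P ∧ ∀ A ∈ t, Q ⊆ A → P ⊆ A := by
    intro Q hQ
    obtain ⟨P₀, hP₀, hQP₀, hφP₀⟩ := hdom Q hQ
    obtain ⟨P, hPP₀, hP⟩ := Finset.exists_le_minimal (t.filter fun A => Q ⊆ A) (a := P₀)
      (by simp [hP₀, hQP₀])
    have hPt := hP.prop
    simp only [Finset.mem_filter] at hPt
    refine ⟨P, hPt.1, hPt.2, hφP₀.trans ?_, fun A hA hQA => ?_⟩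
    · gcongr
      rcases eq_or_ne P P₀ with h | h
      · rw [h]
      · exact (le_mul_of_one_le_left zero_le (by norm_num)).trans
          (hdbl P₀ hP₀ P hPt.1 (hPP₀.ssubset_of_ne h))
    · obtain ⟨x, hx⟩ := hne Q hQ
      rcases ht P hPt.1 A hA ⟨x, hPt.2 hx, hQA hx⟩ with h | h
      · exact h
      · exact hP.le_of_le (by simp [hA, hQA]) h
  choose! π hπt hQπ hφπ hπmin using hprin
  have hmeast : ∀ A ∈ t, MeasurableSet A := fun A hA => hmeas A (hts hA)
  have hGm : ∀ P ∈ t, Measurable (childAverage t γ g P) := fun P hP =>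
    measurable_childAverage hmeast hg hP
  set N : Set X → ℝ≥0∞ := fun P => (∫⁻ x, childAverage t γ g P x ^ r ∂ν) ^ (1 / r) with hN
  have hlocal : ∀ P ∈ t, ∑ Q ∈ s with π Q = P, lam Q * μ Q * ∫⁻ x in Q, g x ∂ν ≤
      B * μ P ^ (1 / p) * N P := by
    intro P hP
    set H : X → ℝ≥0∞ := fun x => ∑ Q ∈ s with Q ⊆ P, Q.indicator (fun _ => lam Q * μ Q) x with hH
    have hHm : Measurable H := Finset.measurable_fun_sum _ fun Q hQ =>
      measurable_const.indicator (hmeas Q (Finset.mem_filter.1 hQ).1)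
    calc ∑ Q ∈ s with π Q = P, lam Q * μ Q * ∫⁻ x in Q, g x ∂ν
        ≤ ∑ Q ∈ s with π Q = P, lam Q * μ Q * ∫⁻ x in Q, childAverage t γ g P x ∂ν := by
          refine Finset.sum_le_sum fun Q hQ => ?_
          obtain ⟨hQs, hQP⟩ := Finset.mem_filter.1 hQ
          gcongr 1
          exact setLIntegral_le_childAverage ht (fun A hA => hne A (hts hA)) hmeast hg
            (fun A hA => hγ A (hts hA)) hP (hmeas Q hQs) (hQP ▸ hQπ Q hQs)
            (fun A hA => hs A (hts hA) Q hQs) (hQP ▸ hπmin Q hQs)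
      _ ≤ ∑ Q ∈ s with Q ⊆ P, lam Q * μ Q * ∫⁻ x in Q, childAverage t γ g P x ∂ν := by
          refine Finset.sum_le_sum_of_subset fun Q hQ => ?_
          obtain ⟨hQs, hQP⟩ := Finset.mem_filter.1 hQ
          exact Finset.mem_filter.2 ⟨hQs, hQP ▸ hQπ Q hQs⟩
      _ = ∫⁻ x, (H * childAverage t γ g P) x ∂ν := by
          simp only [hH, Pi.mul_apply, Finset.sum_mul]
          rw [lintegral_finsetSum' (f := fun (Q : Set X) x =>
            Q.indicator (fun _ => lam Q * μ Q) x * childAverage t γ g P x) _ fun Q hQ =>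
              ((measurable_const.indicator (hmeas Q (Finset.mem_filter.1 hQ).1)).mul
                (hGm P hP)).aemeasurable]
          refine Finset.sum_congr rfl fun Q hQ => ?_
          have hQm := hmeas Q (Finset.mem_filter.1 hQ).1
          rw [← lintegral_const_mul _ (hGm P hP), ← lintegral_indicator hQm]
          refine lintegral_congr fun x => ?_
          by_cases hx : x ∈ Q <;> simp [hx]
      _ ≤ (∫⁻ x, H x ^ r' ∂ν) ^ (1 / r') * N P :=
          ENNReal.lintegral_mul_le_Lp_mul_Lq ν hrr'.symm hHm.aemeasurable (hGm P hP).aemeasurable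
      _ ≤ B * μ P ^ (1 / p) * N P := by
          gcongr
          exact htest P (hts hP)
  have hsumN : (∑ P ∈ t, N P ^ p') ^ (1 / p') ≤ (1 + K ^ p) ^ (1 / r) := by
    have hr := hrr'.pos
    have hp' := hpp'.symm.pos
    have h1 : ∀ P, N P ^ p' = (∫⁻ x, childAverage t γ g P x ^ r ∂ν) ^ (p' / r) := by
      intro P
      rw [hN, ← ENNReal.rpow_mul, one_div_mul_eq_div]
    have h2 : ∑ P ∈ t, ∫⁻ x, childAverage t γ g P x ^ r ∂ν ≤ 1 + K ^ p :=
      (sum_lintegral_childAverage_rpow_le ht hmeast hg hr).trans <| add_le_add hg1 <|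
        (Finset.sum_le_sum fun P hP => hle P (hts hP)).trans hcarl
    calc (∑ P ∈ t, N P ^ p') ^ (1 / p')
        ≤ ((∑ P ∈ t, ∫⁻ x, childAverage t γ g P x ^ r ∂ν) ^ (p' / r)) ^ (1 / p') := by
          simp only [h1]
          gcongr
          exact sum_rpow_le_rpow_sum _ _ ((one_le_div hr).2 hrp)
      _ = (∑ P ∈ t, ∫⁻ x, childAverage t γ g P x ^ r ∂ν) ^ (1 / r) := by
          rw [← ENNReal.rpow_mul]
          congr 1
          field_simp
      _ ≤ (1 + K ^ p) ^ (1 / r) := by gcongr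
  calc ∑ Q ∈ s, lam Q * ((∫⁻ x in Q, f x ∂μ) * ∫⁻ x in Q, g x ∂ν)
      = ∑ P ∈ t, ∑ Q ∈ s with π Q = P, lam Q * ((∫⁻ x in Q, f x ∂μ) * ∫⁻ x in Q, g x ∂ν) :=
        (Finset.sum_fiberwise_of_maps_to hπt _).symm
    _ ≤ ∑ P ∈ t, ∑ Q ∈ s with π Q = P, 2 * φ P * (lam Q * μ Q * ∫⁻ x in Q, g x ∂ν) := by
        refine Finset.sum_le_sum fun P hP => Finset.sum_le_sum fun Q hQ => ?_
        obtain ⟨hQs, hQP⟩ := Finset.mem_filter.1 hQ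
        rw [← hφ Q hQs]
        calc lam Q * (φ Q * μ Q * ∫⁻ x in Q, g x ∂ν)
            = φ Q * (lam Q * μ Q * ∫⁻ x in Q, g x ∂ν) := by ring
          _ ≤ _ := by
            gcongr
            exact hQP ▸ hφπ Q hQs
    _ = ∑ P ∈ t, 2 * φ P * ∑ Q ∈ s with π Q = P, lam Q * μ Q * ∫⁻ x in Q, g x ∂ν := by
        simp only [Finset.mul_sum]
    _ ≤ ∑ P ∈ t, 2 * φ P * (B * μ P ^ (1 / p) * N P) :=
        Finset.sum_le_sum fun P hP => mul_le_mul_right (hlocal P hP) _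
    _ = 2 * B * ∑ P ∈ t, (φ P * μ P ^ (1 / p)) * N P := by
        rw [Finset.mul_sum]
        exact Finset.sum_congr rfl fun P _ => by ring
    _ ≤ 2 * B * ((∑ P ∈ t, (φ P * μ P ^ (1 / p)) ^ p) ^ (1 / p) *
          (∑ P ∈ t, N P ^ p') ^ (1 / p')) := by
        gcongr
        exact ENNReal.inner_le_Lp_mul_Lq _ _ _ hpp'
    _ ≤ 2 * B * (K * (1 + K ^ p) ^ (1 / r)) := by
        gcongr 2 * B * (?_ * ?_)
        · have h1 : ∀ P, (φ P * μ P ^ (1 / p)) ^ p = φ P ^ p * μ P := by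
            intro P
            rw [ENNReal.mul_rpow_of_nonneg _ _ hpp'.nonneg, ← ENNReal.rpow_mul,
              one_div_mul_cancel hpp'.ne_zero, ENNReal.rpow_one]
          simp only [h1]
          have := ENNReal.rpow_le_rpow hcarl hpp'.one_div_nonneg
          rwa [← ENNReal.rpow_mul, mul_one_div_cancel hpp'.ne_zero, ENNReal.rpow_one] at this

end Testing

lemma exists_geometric_bound {a : ℝ} (ha : 0 < a) :
    ∃ K : ℝ≥0∞, K ≠ ⊤ ∧ 1 + K * 2 ^ (-a) ≤ K := by
  have hlt : (2 : ℝ≥0∞) ^ (-a) < 1 :=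
    ENNReal.rpow_lt_one_of_one_lt_of_neg (by norm_num) (by linarith)
  have h0 : 1 - (2 : ℝ≥0∞) ^ (-a) ≠ 0 := (tsub_pos_of_lt hlt).ne'
  have htop : 1 - (2 : ℝ≥0∞) ^ (-a) ≠ ⊤ := ENNReal.sub_ne_top ENNReal.one_ne_top
  refine ⟨(1 - 2 ^ (-a))⁻¹, ENNReal.inv_ne_top.2 h0, le_of_eq ?_⟩
  nth_rw 1 [← ENNReal.inv_mul_cancel h0 htop]
  rw [← mul_add, tsub_add_cancel_of_le hlt.le, mul_one]

section TwoSided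

variable {X : Type*} [MeasurableSpace X] {μ ν : Measure X} {f g : X → ℝ≥0∞}
  {s : Finset (Set X)} {lam : Set X → ℝ≥0∞} {p p' q q' : ℝ} {K L A B : ℝ≥0∞}

open Classical in
/-- Bound of the bilinear form of a positive dyadic operator by the two testing constants. -/
lemma sum_form_le_of_testing (hpp' : p.HolderConjugate p') (hqq' : q.HolderConjugate q')
    (hpq : p ≤ q) (hK : 1 + K * 2 ^ (-(p - 1)) ≤ K) (hL : 1 + L * 2 ^ (-(q' - 1)) ≤ L)
    (hs : NestedFamily s) (hne : ∀ A ∈ s, A.Nonempty) (hmeas : ∀ A ∈ s, MeasurableSet A)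
    (hμ : ∀ A ∈ s, μ A ≠ ⊤) (hν : ∀ A ∈ s, ν A ≠ ⊤)
    (hf : Measurable f) (hf1 : ∫⁻ x, f x ^ p ∂μ ≤ 1)
    (hg : Measurable g) (hg1 : ∫⁻ x, g x ^ q' ∂ν ≤ 1)
    (hA : ∀ R ∈ s, (∫⁻ x, (∑ Q ∈ s with Q ⊆ R, Q.indicator (fun _ => lam Q * μ Q) x) ^ q
      ∂ν) ^ (1 / q) ≤ A * μ R ^ (1 / p))
    (hB : ∀ R ∈ s, (∫⁻ x, (∑ Q ∈ s with Q ⊆ R, Q.indicator (fun _ => lam Q * ν Q) x) ^ p'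
      ∂μ) ^ (1 / p') ≤ B * ν R ^ (1 / q')) :
    ∑ Q ∈ s, lam Q * ((∫⁻ x in Q, f x ∂μ) * ∫⁻ x in Q, g x ∂ν) ≤
      2 * A * (K * (1 + K ^ p) ^ (1 / q')) + 2 * B * (L * (1 + L ^ q') ^ (1 / p)) := by
  have hqp' : q' ≤ p' := by
    have h1 := hpp'.inv_add_inv_eq_one
    have h2 := hqq'.inv_add_inv_eq_one
    have h3 : q⁻¹ ≤ p⁻¹ := inv_anti₀ hpp'.pos hpq
    exact (inv_le_inv₀ hpp'.symm.pos hqq'.symm.pos).1 (by linarith)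
  have hsub : ∀ t ⊆ s, ∀ (R : Set X) (c : Set X → ℝ≥0∞) (x : X),
      ∑ Q ∈ t with Q ⊆ R, Q.indicator (fun _ => c Q) x ≤
        ∑ Q ∈ s with Q ⊆ R, Q.indicator (fun _ => c Q) x := fun t ht R c x =>
    Finset.sum_le_sum_of_subset (Finset.filter_subset_filter _ ht)
  set φ : Set X → ℝ≥0∞ := fun Q => ((∫⁻ x in Q, f x ∂μ) / μ Q) ^ p * μ Q with hφ
  set γ : Set X → ℝ≥0∞ := fun Q => ((∫⁻ x in Q, g x ∂ν) / ν Q) ^ q' * ν Q with hγ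
  have hq0 := hqq'.nonneg
  have hp0' := hpp'.symm.nonneg
  rw [← Finset.sum_filter_add_sum_filter_not s fun Q => γ Q ≤ φ Q]
  refine add_le_add ?_ ?_
  · refine sum_form_le_of_testing_of_le hpp' hqq'.symm hqp' hK (hs.mono (Finset.filter_subset _ _))
      (fun Q hQ => hne Q (Finset.mem_filter.1 hQ).1)
      (fun Q hQ => hmeas Q (Finset.mem_filter.1 hQ).1)
      (fun Q hQ => hμ Q (Finset.mem_filter.1 hQ).1) (fun Q hQ => hν Q (Finset.mem_filter.1 hQ).1)
      hf hf1 hg hg1 (fun Q hQ => (Finset.mem_filter.1 hQ).2) fun R hR => ?_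
    refine le_trans ?_ (hA R (Finset.mem_filter.1 hR).1)
    exact ENNReal.rpow_le_rpow (lintegral_mono fun x => ENNReal.rpow_le_rpow
      (hsub _ (Finset.filter_subset _ _) _ _ x) hq0) hqq'.one_div_nonneg
  · simp only [mul_comm (∫⁻ x in _, f x ∂μ)]
    refine sum_form_le_of_testing_of_le hqq'.symm hpp' hpq hL (hs.mono (Finset.filter_subset _ _))
      (fun Q hQ => hne Q (Finset.mem_filter.1 hQ).1)
      (fun Q hQ => hmeas Q (Finset.mem_filter.1 hQ).1)
      (fun Q hQ => hν Q (Finset.mem_filter.1 hQ).1) (fun Q hQ => hμ Q (Finset.mem_filter.1 hQ).1)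
      hg hg1 hf hf1 (fun Q hQ => (not_le.1 (Finset.mem_filter.1 hQ).2).le) fun R hR => ?_
    refine le_trans ?_ (hB R (Finset.mem_filter.1 hR).1)
    exact ENNReal.rpow_le_rpow (lintegral_mono fun x => ENNReal.rpow_le_rpow
      (hsub _ (Finset.filter_subset _ _) _ _ x) hp0') hpp'.symm.one_div_nonneg

end TwoSided

section Dyadic

variable {d : ℕ}

lemma dcube_nonempty (i : DIdx d) : (dcube i).Nonempty := by
  refine ⟨fun j => 2 ^ i.1 * i.2 j, fun j => ⟨le_rfl, ?_⟩⟩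
  have : (0 : ℝ) < 2 ^ i.1 := by positivity
  nlinarith

lemma measurableSet_dcube (i : DIdx d) : MeasurableSet (dcube i) := by
  have : dcube i = Set.univ.pi fun j =>
      Set.Ico ((2 : ℝ) ^ i.1 * (i.2 j : ℝ)) ((2 : ℝ) ^ i.1 * ((i.2 j : ℝ) + 1)) := by
    ext x; simp [dcube]
  rw [this]
  exact MeasurableSet.univ_pi fun j => measurableSet_Ico

lemma dcube_subset_of_le {i j : DIdx d} (h : (dcube i ∩ dcube j).Nonempty) (hij : i.1 ≤ j.1) :
    dcube i ⊆ dcube j := by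
  obtain ⟨x, hxi, hxj⟩ := h
  obtain ⟨m, hm⟩ := Int.eq_ofNat_of_zero_le (sub_nonneg.2 hij)
  have hpow : (2 : ℝ) ^ j.1 = 2 ^ i.1 * 2 ^ m := by
    rw [← zpow_natCast, ← zpow_add₀ two_ne_zero]
    congr 1
    omega
  have h0 : (0 : ℝ) < 2 ^ i.1 := by positivity
  intro y hy l
  obtain ⟨a1, a2⟩ := hxi l
  obtain ⟨b1, b2⟩ := hxj l
  obtain ⟨c1, c2⟩ := hy l
  rw [hpow, mul_assoc] at b1 b2 ⊢
  rw [mul_assoc]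
  have e1 : (2 : ℤ) ^ m * j.2 l ≤ i.2 l := by
    have := lt_of_mul_lt_mul_left (b1.trans_lt a2) h0.le
    exact Int.lt_add_one_iff.1 (by exact_mod_cast this)
  have e2 : i.2 l + 1 ≤ (2 : ℤ) ^ m * (j.2 l + 1) := by
    have := lt_of_mul_lt_mul_left (a1.trans_lt b2) h0.le
    exact Int.add_one_le_iff.2 (by exact_mod_cast this)
  have e1' : (2 : ℝ) ^ m * j.2 l ≤ i.2 l := by exact_mod_cast e1
  have e2' : (i.2 l : ℝ) + 1 ≤ (2 : ℝ) ^ m * (j.2 l + 1) := by exact_mod_cast e2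
  exact ⟨(mul_le_mul_of_nonneg_left e1' h0.le).trans c1,
    c2.trans_le (mul_le_mul_of_nonneg_left e2' h0.le)⟩

lemma dcube_subset_or_subset {i j : DIdx d} (h : (dcube i ∩ dcube j).Nonempty) :
    dcube i ⊆ dcube j ∨ dcube j ⊆ dcube i := by
  rcases le_total i.1 j.1 with h' | h'
  · exact Or.inl (dcube_subset_of_le h h')
  · exact Or.inr (dcube_subset_of_le (Set.inter_comm _ _ ▸ h) h')

lemma sigmaFinite_wMeasure {ω : (Fin d → ℝ) → ℝ≥0∞} (h : ∀ i : DIdx d, wMeasure ω (dcube i) ≠ ⊤) :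
    SigmaFinite (wMeasure ω) := by
  refine Measure.sigmaFinite_of_countable (S := Set.range dcube) (Set.countable_range _) ?_ ?_
  · rintro _ ⟨i, rfl⟩
    exact (h i).lt_top
  · refine Set.eq_univ_of_forall fun x => ⟨_, ⟨(0, fun j => ⌊x j⌋), rfl⟩, fun j => ?_⟩
    simp [Int.floor_le, Int.lt_floor_add_one]

lemma lavg_mul_weight {f σ : (Fin d → ℝ) → ℝ≥0∞} (hf : Measurable f) (hσ : Measurable σ)
    (i : DIdx d) : lavg i (fun y => f y * σ y) =
      (∫⁻ x in dcube i, f x ∂wMeasure σ) / volume (dcube i) := by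
  rw [wMeasure, setLIntegral_withDensity_eq_setLIntegral_mul _ hσ hf (measurableSet_dcube i)]
  simp [lavg, cavg, mul_comm]

lemma lavg_indicator {σ : (Fin d → ℝ) → ℝ≥0∞} {i R : DIdx d} (h : dcube i ⊆ dcube R) :
    lavg i ((dcube R).indicator σ) = wMeasure σ (dcube i) / volume (dcube i) := by
  rw [lavg, cavg, setLIntegral_indicator (measurableSet_dcube R), Set.inter_eq_right.2 h, wMeasure,
    withDensity_apply _ (measurableSet_dcube i)]

lemma measurable_tsum_indicator_dcube {ι : Type*} [Countable ι] (e : ι → DIdx d) (c : ι → ℝ≥0∞) :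
    Measurable fun x => ∑' i, (dcube (e i)).indicator (fun _ => c i) x :=
  Measurable.tsum fun i => measurable_const.indicator (measurableSet_dcube (e i))

lemma lintegral_tsum_indicator_dcube_mul {ι : Type*} [Countable ι] (e : ι → DIdx d)
    (c : ι → ℝ≥0∞) {ν : Measure (Fin d → ℝ)} {g : (Fin d → ℝ) → ℝ≥0∞} (hg : Measurable g) :
    ∫⁻ x, (∑' i, (dcube (e i)).indicator (fun _ => c i) x) * g x ∂ν =
      ∑' i, c i * ∫⁻ x in dcube (e i), g x ∂ν := by
  simp only [← ENNReal.tsum_mul_right]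
  rw [lintegral_tsum (f := fun i x => (dcube (e i)).indicator (fun _ => c i) x * g x)
    fun i => ((measurable_const.indicator
    (measurableSet_dcube (e i))).mul hg).aemeasurable]
  refine tsum_congr fun i => ?_
  rw [← lintegral_const_mul _ hg, ← lintegral_indicator (measurableSet_dcube (e i))]
  refine lintegral_congr fun x => ?_
  by_cases hx : x ∈ dcube (e i) <;> simp [hx]

lemma lintegral_rpow_le_one_of_lpn_le_one {p : ℝ} (hp : 0 < p) {μ : Measure (Fin d → ℝ)}
    {f : (Fin d → ℝ) → ℝ≥0∞} (h : lpn p μ f ≤ 1) : ∫⁻ x, f x ^ p ∂μ ≤ 1 := by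
  have := ENNReal.rpow_le_rpow h hp.le
  rwa [lpn, ← ENNReal.rpow_mul, one_div_mul_cancel hp.ne', ENNReal.rpow_one,
    ENNReal.one_rpow] at this

lemma lpn_le_one_of_lintegral_rpow_le_one {p : ℝ} (hp : 0 < p) {μ : Measure (Fin d → ℝ)}
    {f : (Fin d → ℝ) → ℝ≥0∞} (h : ∫⁻ x, f x ^ p ∂μ ≤ 1) : lpn p μ f ≤ 1 := by
  have := ENNReal.rpow_le_rpow h (one_div_nonneg.2 hp.le)
  rwa [ENNReal.one_rpow] at this

lemma lpn_mono {p : ℝ} (hp : 0 < p) {μ : Measure (Fin d → ℝ)} {f g : (Fin d → ℝ) → ℝ≥0∞}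
    (h : ∀ x, f x ≤ g x) : lpn p μ f ≤ lpn p μ g := by
  unfold lpn
  gcongr
  exact h _

lemma lpn_const_mul {p : ℝ} (hp : 0 < p) {μ : Measure (Fin d → ℝ)} {f : (Fin d → ℝ) → ℝ≥0∞}
    (hf : Measurable f) (c : ℝ≥0∞) : lpn p μ (fun x => c * f x) = c * lpn p μ f := by
  simp only [lpn, ENNReal.mul_rpow_of_nonneg _ _ hp.le]
  rw [lintegral_const_mul _ (hf.pow_const p), ENNReal.mul_rpow_of_nonneg _ _ (by positivity),
    ← ENNReal.rpow_mul, mul_one_div_cancel hp.ne', ENNReal.rpow_one]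

lemma rpow_neg_mul_rpow_self {m : ℝ≥0∞} (h0 : m ≠ 0) (htop : m ≠ ⊤) (a : ℝ) :
    m ^ (-a) * m ^ a = 1 := by
  rw [← ENNReal.rpow_add _ _ h0 htop, neg_add_cancel, ENNReal.rpow_zero]

variable {τ : DIdx d → ℝ≥0∞} {σ ω : (Fin d → ℝ) → ℝ≥0∞} {p q : ℝ}

lemma measurable_Tdy (f : (Fin d → ℝ) → ℝ≥0∞) : Measurable (Tdy τ f) :=
  measurable_tsum_indicator_dcube (fun i => i) _

lemma measurable_TdyIn (R : DIdx d) (f : (Fin d → ℝ) → ℝ≥0∞) : Measurable (TdyIn τ R f) :=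
  measurable_tsum_indicator_dcube Subtype.val _

lemma lpn_TdyIn_le_of_testing {ν : Measure (Fin d → ℝ)} {e a : ℝ} (he : 0 < e) {B : ℝ≥0∞}
    {R : DIdx d} (hfin : wMeasure σ (dcube R) ≠ ⊤)
    (hB : wMeasure σ (dcube R) ≠ 0 →
      wMeasure σ (dcube R) ^ (-a) * lpn e ν (TdyIn τ R ((dcube R).indicator σ)) ≤ B) :
    lpn e ν (TdyIn τ R ((dcube R).indicator σ)) ≤ B * wMeasure σ (dcube R) ^ a := by
  rcases eq_or_ne (wMeasure σ (dcube R)) 0 with h0 | h0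
  · have : ∀ x, TdyIn τ R ((dcube R).indicator σ) x = 0 := by
      intro x
      refine ENNReal.tsum_eq_zero.2 fun i => ?_
      rw [lavg_indicator i.2, measure_mono_null i.2 h0]
      simp
    simp only [lpn, this, ENNReal.zero_rpow_of_pos he, lintegral_zero,
      ENNReal.zero_rpow_of_pos (one_div_pos.2 he)]
    exact zero_le
  · calc lpn e ν (TdyIn τ R ((dcube R).indicator σ))
        = wMeasure σ (dcube R) ^ (-a) * lpn e ν (TdyIn τ R ((dcube R).indicator σ)) *
            wMeasure σ (dcube R) ^ a := by
          rw [mul_right_comm, rpow_neg_mul_rpow_self h0 hfin, one_mul]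
      _ ≤ _ := by
          gcongr
          exact hB h0

open Classical in
lemma sum_indicator_dcube_le_TdyIn (S : Finset (DIdx d)) (R : DIdx d) (x : Fin d → ℝ) :
    ∑ Q ∈ S.image dcube with Q ⊆ dcube R, Q.indicator
      (fun _ => (∑ i ∈ S with dcube i = Q, τ i / volume (dcube i)) * wMeasure σ Q) x ≤
    TdyIn τ R ((dcube R).indicator σ) x := by
  have h1 : ∀ Q ∈ (S.image dcube).filter (· ⊆ dcube R), Q.indicator
      (fun _ => (∑ i ∈ S with dcube i = Q, τ i / volume (dcube i)) * wMeasure σ Q) x =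
      ∑ i ∈ S.filter (dcube · ⊆ dcube R) with dcube i = Q,
        (dcube i).indicator (fun _ => τ i * lavg i ((dcube R).indicator σ)) x := by
    intro Q hQ
    have hQR := (Finset.mem_filter.1 hQ).2
    have h2 : (S.filter (dcube · ⊆ dcube R)).filter (dcube · = Q) =
        S.filter (dcube · = Q) := by
      ext i
      simp only [Finset.mem_filter]
      exact ⟨fun h => ⟨h.1.1, h.2⟩, fun h => ⟨⟨h.1, h.2 ▸ hQR⟩, h.2⟩⟩
    rw [h2]
    by_cases hx : x ∈ Q
    · rw [Set.indicator_of_mem hx, Finset.sum_mul]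
      refine Finset.sum_congr rfl fun i hi => ?_
      obtain ⟨_, rfl⟩ := Finset.mem_filter.1 hi
      rw [Set.indicator_of_mem hx, lavg_indicator hQR]
      simp only [div_eq_mul_inv]
      ring
    · rw [Set.indicator_of_notMem hx]
      refine (Finset.sum_eq_zero fun i hi => ?_).symm
      obtain ⟨_, rfl⟩ := Finset.mem_filter.1 hi
      exact Set.indicator_of_notMem hx _
  rw [Finset.sum_congr rfl h1, Finset.sum_fiberwise_of_maps_to, ← Finset.sum_subtype_eq_sum_filter]
  · exact ENNReal.sum_le_tsum _
  · intro i hi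
    obtain ⟨hi, hiR⟩ := Finset.mem_filter.1 hi
    exact Finset.mem_filter.2 ⟨Finset.mem_image_of_mem _ hi, hiR⟩

lemma locTestDual_le_strongConst (hp : 0 < p) (hq : 0 < q) (hσ : Measurable σ)
    (hσfin : ∀ i : DIdx d, wMeasure σ (dcube i) ≠ ⊤) :
    locTestDual p q τ σ ω ≤ strongConst p q τ σ ω := by
  refine iSup₂_le fun R hR => ?_
  set c := wMeasure σ (dcube R) ^ (-(1 / p)) with hc
  have hRm := measurableSet_dcube R
  have hfm : Measurable ((dcube R).indicator fun _ => c) := measurable_const.indicator hRm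
  have hf1 : lpn p (wMeasure σ) ((dcube R).indicator fun _ => c) ≤ 1 := by
    refine lpn_le_one_of_lintegral_rpow_le_one hp (le_of_eq ?_)
    have : ∀ x, (dcube R).indicator (fun _ => c) x ^ p =
        (dcube R).indicator (fun _ => c ^ p) x := by
      intro x
      by_cases hx : x ∈ dcube R <;> simp [hx, hp]
    simp only [this]
    rw [lintegral_indicator_const hRm, hc, ← ENNReal.rpow_mul, neg_mul,
      one_div_mul_cancel hp.ne', ENNReal.rpow_neg_one, ENNReal.inv_mul_cancel hR (hσfin R)]
  refine le_trans ?_ (le_iSup_of_le ((dcube R).indicator fun _ => c) <|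
    le_iSup₂_of_le hfm hf1 le_rfl)
  rw [← lpn_const_mul hq (measurable_TdyIn R _)]
  refine lpn_mono hq fun x => ?_
  rw [TdyIn, ← ENNReal.tsum_mul_left]
  refine le_trans (ENNReal.tsum_le_tsum fun i => ?_)
    (ENNReal.tsum_comp_le_tsum_of_injective Subtype.val_injective _)
  rw [lavg_indicator i.2, lavg_mul_weight hfm hσ, setLIntegral_indicator hRm,
    Set.inter_eq_right.2 i.2, setLIntegral_const]
  refine le_of_eq ?_
  by_cases hx : x ∈ dcube i.1
  · simp only [hx, Set.indicator_of_mem, div_eq_mul_inv]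
    ring
  · simp [hx]

lemma locTest_le_strongConst (hp : 1 < p) (hq : 1 < q) (hσ : Measurable σ)
    (hσfin : ∀ i : DIdx d, wMeasure σ (dcube i) ≠ ⊤)
    (hωfin : ∀ i : DIdx d, wMeasure ω (dcube i) ≠ ⊤) :
    locTest p q τ σ ω ≤ strongConst p q τ σ ω := by
  have hpp' : p.HolderConjugate (p / (p - 1)) := Real.HolderConjugate.conjExponent hp
  have hqq' : q.HolderConjugate (q / (q - 1)) := Real.HolderConjugate.conjExponent hq
  have := sigmaFinite_wMeasure hσfin
  refine iSup₂_le fun R hR => ?_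
  have hRm := measurableSet_dcube R
  set q' := q / (q - 1) with hq'
  have key : lpn (p / (p - 1)) (wMeasure σ) (TdyIn τ R ((dcube R).indicator ω)) ≤
      strongConst p q τ σ ω * wMeasure ω (dcube R) ^ (1 / q') := by
    refine rpow_lintegral_le_of_forall_dual hpp'.symm (measurable_TdyIn R _) fun g hg hg1 => ?_
    have hone : Measurable ((dcube R).indicator fun _ => (1 : ℝ≥0∞)) :=
      measurable_const.indicator hRm
    calc ∫⁻ x, TdyIn τ R ((dcube R).indicator ω) x * g x ∂wMeasure σ
        = ∑' i : {i : DIdx d // dcube i ⊆ dcube R},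
            τ i.1 * lavg i.1 ((dcube R).indicator ω) * ∫⁻ x in dcube i.1, g x ∂wMeasure σ :=
          lintegral_tsum_indicator_dcube_mul Subtype.val _ hg
      _ = ∑' i : {i : DIdx d // dcube i ⊆ dcube R}, τ i.1 * lavg i.1 (fun y => g y * σ y) *
            ∫⁻ x in dcube i.1, (dcube R).indicator (fun _ => (1 : ℝ≥0∞)) x ∂wMeasure ω := by
          refine tsum_congr fun i => ?_
          rw [lavg_indicator i.2, lavg_mul_weight hg hσ, setLIntegral_indicator hRm,
            Set.inter_eq_right.2 i.2, setLIntegral_const]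
          simp only [div_eq_mul_inv]
          ring
      _ ≤ ∑' i : DIdx d, τ i * lavg i (fun y => g y * σ y) *
            ∫⁻ x in dcube i, (dcube R).indicator (fun _ => (1 : ℝ≥0∞)) x ∂wMeasure ω :=
          ENNReal.tsum_comp_le_tsum_of_injective Subtype.val_injective
            fun i : DIdx d => τ i * lavg i (fun y => g y * σ y) *
              ∫⁻ x in dcube i, (dcube R).indicator (fun _ => (1 : ℝ≥0∞)) x ∂wMeasure ω
      _ = ∫⁻ x, Tdy τ (fun y => g y * σ y) x *
            (dcube R).indicator (fun _ => (1 : ℝ≥0∞)) x ∂wMeasure ω :=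
          (lintegral_tsum_indicator_dcube_mul (fun i => i) _ hone).symm
      _ ≤ lpn q (wMeasure ω) (Tdy τ fun y => g y * σ y) *
            (∫⁻ x, (dcube R).indicator (fun _ => (1 : ℝ≥0∞)) x ^ q' ∂wMeasure ω) ^ (1 / q') :=
          ENNReal.lintegral_mul_le_Lp_mul_Lq _ hqq' (measurable_Tdy _).aemeasurable
            hone.aemeasurable
      _ ≤ strongConst p q τ σ ω * wMeasure ω (dcube R) ^ (1 / q') := by
          gcongr
          · exact le_iSup_of_le g <| le_iSup₂_of_le hg
              (lpn_le_one_of_lintegral_rpow_le_one hpp'.pos hg1) le_rfl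
          · rw [← lintegral_indicator_one hRm]
            refine lintegral_mono fun x => ?_
            by_cases hx : x ∈ dcube R <;> simp [hx, hqq'.symm.pos]
  calc wMeasure ω (dcube R) ^ (-(1 / q')) *
        lpn (p / (p - 1)) (wMeasure σ) (TdyIn τ R ((dcube R).indicator ω))
      ≤ wMeasure ω (dcube R) ^ (-(1 / q')) *
          (strongConst p q τ σ ω * wMeasure ω (dcube R) ^ (1 / q')) := by gcongr
    _ = strongConst p q τ σ ω := by
        rw [mul_left_comm, rpow_neg_mul_rpow_self hR (hωfin R), mul_one]

lemma strongConst_le_of_geometric_bounds {K L : ℝ≥0∞} (hp : 1 < p) (hpq : p ≤ q)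
    (hK : 1 + K * 2 ^ (-(p - 1)) ≤ K) (hL : 1 + L * 2 ^ (-(q / (q - 1) - 1)) ≤ L)
    (hσ : Measurable σ) (hσfin : ∀ i : DIdx d, wMeasure σ (dcube i) ≠ ⊤)
    (hωfin : ∀ i : DIdx d, wMeasure ω (dcube i) ≠ ⊤) :
    strongConst p q τ σ ω ≤
      2 * locTestDual p q τ σ ω * (K * (1 + K ^ p) ^ (1 / (q / (q - 1)))) +
      2 * locTest p q τ σ ω * (L * (1 + L ^ (q / (q - 1))) ^ (1 / p)) := by
  classical
  have hpp' : p.HolderConjugate (p / (p - 1)) := Real.HolderConjugate.conjExponent hp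
  have hqq' : q.HolderConjugate (q / (q - 1)) :=
    Real.HolderConjugate.conjExponent (hp.trans_le hpq)
  have := sigmaFinite_wMeasure hωfin
  refine iSup_le fun f => iSup₂_le fun hf hf1 => ?_
  replace hf1 := lintegral_rpow_le_one_of_lpn_le_one hpp'.pos hf1
  refine rpow_lintegral_le_of_forall_dual hqq' (measurable_Tdy _) fun g hg hg1 => ?_
  refine (lintegral_tsum_indicator_dcube_mul (fun i => i) _ hg).trans_le ?_
  rw [ENNReal.tsum_eq_iSup_sum]
  refine iSup_le fun S => ?_
  set lam : Set (Fin d → ℝ) → ℝ≥0∞ := fun Q => ∑ i ∈ S with dcube i = Q, τ i / volume (dcube i)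
    with hlam
  have hform : ∑ i ∈ S, τ i * lavg i (fun y => f y * σ y) * ∫⁻ x in dcube i, g x ∂wMeasure ω =
      ∑ Q ∈ S.image dcube,
        lam Q * ((∫⁻ x in Q, f x ∂wMeasure σ) * ∫⁻ x in Q, g x ∂wMeasure ω) := by
    rw [← Finset.sum_fiberwise_of_maps_to (g := dcube) (t := S.image dcube)
      fun i hi => Finset.mem_image_of_mem _ hi]
    refine Finset.sum_congr rfl fun Q _ => ?_
    rw [hlam, Finset.sum_mul]
    refine Finset.sum_congr rfl fun i hi => ?_
    obtain ⟨_, rfl⟩ := Finset.mem_filter.1 hi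
    rw [lavg_mul_weight hf hσ]
    simp only [div_eq_mul_inv]
    ring
  have himage : ∀ P : Set (Fin d → ℝ) → Prop, (∀ i, P (dcube i)) → ∀ Q ∈ S.image dcube, P Q := by
    intro P hP Q hQ
    obtain ⟨i, _, rfl⟩ := Finset.mem_image.1 hQ
    exact hP i
  rw [hform]
  refine sum_form_le_of_testing hpp' hqq' hpq hK hL ?_ (himage _ dcube_nonempty)
    (himage _ measurableSet_dcube) (himage _ hσfin) (himage _ hωfin) hf hf1 hg hg1
    (himage _ fun R => ?_) (himage _ fun R => ?_)
  · exact himage _ fun i => himage _ fun j => dcube_subset_or_subset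
  · refine (lpn_mono hqq'.pos fun x => sum_indicator_dcube_le_TdyIn S R x).trans ?_
    exact lpn_TdyIn_le_of_testing hqq'.pos (hσfin R) fun h =>
      le_iSup₂_of_le (f := fun (R : DIdx d) (_ : wMeasure σ (dcube R) ≠ 0) =>
        wMeasure σ (dcube R) ^ (-(1 / p)) *
          lpn q (wMeasure ω) (TdyIn τ R ((dcube R).indicator σ))) R h le_rfl
  · refine (lpn_mono hpp'.symm.pos fun x => sum_indicator_dcube_le_TdyIn S R x).trans ?_
    exact lpn_TdyIn_le_of_testing hpp'.symm.pos (hωfin R) fun h =>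
      le_iSup₂_of_le (f := fun (R : DIdx d) (_ : wMeasure ω (dcube R) ≠ 0) =>
        wMeasure ω (dcube R) ^ (-(1 / (q / (q - 1)))) *
          lpn (p / (p - 1)) (wMeasure σ) (TdyIn τ R ((dcube R).indicator ω))) R h le_rfl

end Dyadic

/-- **Strong-type characterization by local testing, `1 < p ≤ q < ∞`.** -/
theorem stmt6 (d : ℕ) (p q : ℝ) (hp : 1 < p) (hpq : p ≤ q) :
    ∃ c C : ℝ≥0∞, 0 < c ∧ c < ⊤ ∧ 0 < C ∧ C < ⊤ ∧
      ∀ (τ : DIdx d → ℝ≥0∞) (σ ω : (Fin d → ℝ) → ℝ≥0∞),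
        Measurable σ → Measurable ω →
        (∀ i : DIdx d, wMeasure σ (dcube i) ≠ ⊤) →
        (∀ i : DIdx d, wMeasure ω (dcube i) ≠ ⊤) →
        c * (locTest p q τ σ ω + locTestDual p q τ σ ω) ≤ strongConst p q τ σ ω ∧
          strongConst p q τ σ ω ≤ C * (locTest p q τ σ ω + locTestDual p q τ σ ω) := by
  have hq : 1 < q := hp.trans_le hpq
  have hpp' : p.HolderConjugate (p / (p - 1)) := Real.HolderConjugate.conjExponent hp
  have hqq' : q.HolderConjugate (q / (q - 1)) := Real.HolderConjugate.conjExponent hq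
  obtain ⟨K, hKtop, hK⟩ := exists_geometric_bound hpp'.sub_one_pos
  obtain ⟨L, hLtop, hL⟩ := exists_geometric_bound hqq'.symm.sub_one_pos
  set a := K * (1 + K ^ p) ^ (1 / (q / (q - 1))) with ha
  set b := L * (1 + L ^ (q / (q - 1))) ^ (1 / p) with hb
  have hatop : a ≠ ⊤ := ENNReal.mul_ne_top hKtop <|
    ENNReal.rpow_ne_top_of_nonneg hqq'.symm.one_div_nonneg <|
      ENNReal.add_ne_top.2 ⟨ENNReal.one_ne_top, ENNReal.rpow_ne_top_of_nonneg hpp'.nonneg hKtop⟩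
  have hbtop : b ≠ ⊤ := ENNReal.mul_ne_top hLtop <|
    ENNReal.rpow_ne_top_of_nonneg hpp'.one_div_nonneg <|
      ENNReal.add_ne_top.2
        ⟨ENNReal.one_ne_top, ENNReal.rpow_ne_top_of_nonneg hqq'.symm.nonneg hLtop⟩
  refine ⟨2⁻¹, 2 * (a + b) + 1, by simp, by simp, by simp, ?_, ?_⟩
  · exact ENNReal.add_lt_top.2 ⟨ENNReal.mul_lt_top (by simp)
      (ENNReal.add_lt_top.2 ⟨hatop.lt_top, hbtop.lt_top⟩), ENNReal.one_lt_top⟩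
  intro τ σ ω hσ _ hσfin hωfin
  constructor
  · calc 2⁻¹ * (locTest p q τ σ ω + locTestDual p q τ σ ω)
        ≤ 2⁻¹ * (strongConst p q τ σ ω + strongConst p q τ σ ω) := by
          gcongr
          · exact locTest_le_strongConst hp hq hσ hσfin hωfin
          · exact locTestDual_le_strongConst hpp'.pos hqq'.pos hσ hσfin
      _ = strongConst p q τ σ ω := by
          rw [← two_mul, ← mul_assoc, ENNReal.inv_mul_cancel (by simp) (by simp), one_mul]
  · refine (strongConst_le_of_geometric_bounds hp hpq hK hL hσ hσfin hωfin).trans ?_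
    rw [← ha, ← hb]
    set A := locTest p q τ σ ω
    set B := locTestDual p q τ σ ω
    calc 2 * B * a + 2 * A * b
        ≤ 2 * B * a + 2 * A * b + (2 * A * a + 2 * B * b + (A + B)) := le_self_add
      _ = (2 * (a + b) + 1) * (A + B) := by ring
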